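/- Fix odd n = 2m+1 ≥ 5 and let π_1 be the rational Poisson matrix on {v ∈ ℝ^n : v_i ≠ 0 for all i} determined by τ_{ii} = v_{2i−1}, τ_{ij} = −τ_{ji} = v_{2i−1} Π_{k=i}^{j−1}(v_{2k+1}/v_{2k}) for i < j, and the brackets {v_i,v_j} = (−1)^{i+j−1} τ_{⌊i/2⌋+1,⌊(j+1)/2⌋} for 1 ≤ i < j ≤ n−2, {v_i,v_{n−1}} = {v_i,v_n} = ((−1)^{i+n}/2) τ_{⌊i/2⌋+1,⌊n/2⌋} for i = 1,…,n−2, {v_{n−1},v_n} = (1/2)(v_n − v_{n−1}). Then the function F(v) = (v_n − v_{n−1}) Π_{i=1}^{n−2} v_i is a Casimir of π_1, i.e. π_1(v)·∇F(v) = 0 for every v in this open set. -/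

import Mathlib

/-- `coord n x i` is the 1-based `i`-th coordinate `v_i` of `x : ℝⁿ` (0 out of range). -/
noncomputable def coord (n : ℕ) (x : Fin n → ℝ) (i : ℕ) : ℝ :=
  if h : 1 ≤ i ∧ i ≤ n then x ⟨i - 1, by omega⟩ else 0

/-- `τ_{ij} = v_{2i-1} Π_{k=i}^{j-1} (v_{2k+1}/v_{2k})` for `i ≤ j` (so `τ_{ii} = v_{2i-1}`). -/
noncomputable def tauD (n : ℕ) (x : Fin n → ℝ) (i j : ℕ) : ℝ :=
  coord n x (2*i - 1) * ∏ k ∈ Finset.Ico i j, (coord n x (2*k + 1) / coord n x (2*k))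

/-- The linear/rational bracket `{v_i, v_j}` (for `i < j`) of the `D_{n+1}` Volterra system. -/
noncomputable def pi1B (n : ℕ) (x : Fin n → ℝ) (i j : ℕ) : ℝ :=
  if 1 ≤ i ∧ i < j ∧ j ≤ n - 2 then
    (-1 : ℝ)^(i + j - 1) * tauD n x (i/2 + 1) ((j+1)/2)
  else if 1 ≤ i ∧ i ≤ n - 2 ∧ (j = n - 1 ∨ j = n) then
    ((-1 : ℝ)^(i + n) / 2) * tauD n x (i/2 + 1) (n/2)
  else if i = n - 1 ∧ j = n then (1/2) * (coord n x n - coord n x (n-1))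
  else 0

/-- The skew-symmetric matrix `π₁` (1-based entries `π₁_{ij} = {v_i, v_j}`). -/
noncomputable def pi1 (n : ℕ) (x : Fin n → ℝ) (i j : ℕ) : ℝ :=
  if i < j then pi1B n x i j else if j < i then -(pi1B n x j i) else 0

/-- The function `F = (v_n - v_{n-1}) Π_{i=1}^{n-2} v_i`. -/
noncomputable def Ffun (n : ℕ) (x : Fin n → ℝ) : ℝ :=
  (coord n x n - coord n x (n-1)) * ∏ i ∈ Finset.Icc 1 (n-2), coord n x i

lemma coord_ne {n : ℕ} {x : Fin n → ℝ} (hx : ∀ i, x i ≠ 0) {i : ℕ} (h1 : 1 ≤ i) (h2 : i ≤ n) :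
    coord n x i ≠ 0 := by
  unfold coord
  rw [dif_pos ⟨h1, h2⟩]
  exact hx _

lemma coord_single {n : ℕ} (l : Fin n) {i : ℕ} (h1 : 1 ≤ i) (h2 : i ≤ n) :
    coord n (Pi.single l 1) i = if i = (l : ℕ) + 1 then 1 else 0 := by
  unfold coord
  rw [dif_pos ⟨h1, h2⟩, Pi.single_apply]
  congr 1
  rw [Fin.ext_iff, eq_iff_iff]
  simp only
  omega

lemma coord_hasFDerivAt (n : ℕ) (x : Fin n → ℝ) (i : ℕ) :
    ∃ L : (Fin n → ℝ) →L[ℝ] ℝ, (∀ y, L y = coord n y i) ∧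
      HasFDerivAt (fun y => coord n y i) L x := by
  by_cases h : 1 ≤ i ∧ i ≤ n
  · refine ⟨ContinuousLinearMap.proj ⟨i - 1, by omega⟩, ?_, ?_⟩
    · intro y
      simp [coord, h]
    · simp only [coord, dif_pos h]
      exact hasFDerivAt_apply _ _
  · refine ⟨0, ?_, ?_⟩
    · intro y
      simp only [coord, dif_neg h]
      rfl
    · simp only [coord, dif_neg h]
      exact hasFDerivAt_const _ _

lemma fderiv_Ffun (n : ℕ) (x y : Fin n → ℝ) :
    fderiv ℝ (Ffun n) x y =
      (coord n y n - coord n y (n-1)) * (∏ i ∈ Finset.Icc 1 (n-2), coord n x i) +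
      (coord n x n - coord n x (n-1)) *
        ∑ i ∈ Finset.Icc 1 (n-2), (∏ j ∈ (Finset.Icc 1 (n-2)).erase i, coord n x j)
          * coord n y i := by
  choose L hL1 hL2 using coord_hasFDerivAt n x
  have h1 := (hL2 n).sub (hL2 (n-1))
  have h2 := HasFDerivAt.finsetProd (u := Finset.Icc 1 (n-2)) (fun i _ => hL2 i)
  have h3 := h1.mul h2
  have h4 : HasFDerivAt (Ffun n) _ x := h3
  rw [h4.fderiv]
  simp [hL1]
  ring

/-- gradient of `F`, as a function of the 1-based index -/
noncomputable def grd (n : ℕ) (x : Fin n → ℝ) (j : ℕ) : ℝ :=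
  if j = n then ∏ i ∈ Finset.Icc 1 (n-2), coord n x i
  else if j = n - 1 then - ∏ i ∈ Finset.Icc 1 (n-2), coord n x i
  else Ffun n x / coord n x j

lemma fderiv_grd (n : ℕ) (hn : 3 ≤ n) (x : Fin n → ℝ) (hx : ∀ i, x i ≠ 0) (l : Fin n) :
    fderiv ℝ (Ffun n) x (Pi.single l 1) = grd n x ((l : ℕ) + 1) := by
  have hl := l.2
  rw [fderiv_Ffun, coord_single l (by omega) le_rfl, coord_single l (by omega) (by omega)]
  have hs : ∑ i ∈ Finset.Icc 1 (n-2), (∏ j ∈ (Finset.Icc 1 (n-2)).erase i, coord n x j)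
          * coord n (Pi.single l 1) i =
      ∑ i ∈ Finset.Icc 1 (n-2), if i = (l : ℕ) + 1 then
        (∏ j ∈ (Finset.Icc 1 (n-2)).erase i, coord n x j) else 0 := by
    apply Finset.sum_congr rfl
    intro i hi
    rw [Finset.mem_Icc] at hi
    rw [coord_single l (by omega) (by omega)]
    simp
  rw [hs, Finset.sum_ite_eq']
  unfold grd
  by_cases h1 : (l : ℕ) + 1 = n
  · rw [if_pos h1, if_pos h1.symm, if_neg (by omega), if_neg (by rw [Finset.mem_Icc]; omega)]
    ring
  by_cases h2 : (l : ℕ) + 1 = n - 1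
  · rw [if_neg h1, if_pos h2, if_neg (fun h => h1 h.symm), if_pos h2.symm,
      if_neg (by rw [Finset.mem_Icc]; omega)]
    ring
  · have hmem : (l : ℕ) + 1 ∈ Finset.Icc 1 (n-2) := by rw [Finset.mem_Icc]; omega
    rw [if_neg h1, if_neg h2, if_neg (fun h => h1 h.symm), if_neg (fun h => h2 h.symm),
      if_pos hmem, eq_div_iff (coord_ne hx (by omega) (by omega))]
    unfold Ffun
    rw [← Finset.mul_prod_erase _ _ hmem]
    ring

lemma tauD_self (n : ℕ) (x : Fin n → ℝ) (a : ℕ) : tauD n x a a = coord n x (2*a-1) := by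
  simp [tauD]

lemma tauD_right (n : ℕ) (x : Fin n → ℝ) {a b : ℕ} (h : a ≤ b) :
    tauD n x a (b+1) = tauD n x a b * (coord n x (2*b+1) / coord n x (2*b)) := by
  unfold tauD
  rw [Finset.prod_Ico_succ_top h, mul_assoc]

lemma tauD_left {n : ℕ} {x : Fin n → ℝ} {b c : ℕ} (h : b < c) (hv : coord n x (2*b) ≠ 0) :
    tauD n x b c * coord n x (2*b) = coord n x (2*b-1) * tauD n x (b+1) c := by
  unfold tauD
  rw [Finset.prod_eq_prod_Ico_succ_bot h]
  have : 2*(b+1)-1 = 2*b+1 := by omega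
  rw [this]
  field_simp

lemma sum_pairs_low (h : ℕ → ℝ) (c : ℕ) (hh : ∀ b < c, h (2*b+1) + h (2*b+2) = 0) :
    ∑ l ∈ Finset.range (2*c), h (l+1) = 0 := by
  induction c with
  | zero => simp
  | succ c ih =>
    rw [show 2*(c+1) = 2*c+1+1 by ring, Finset.sum_range_succ, Finset.sum_range_succ,
      ih (fun b hb => hh b (by omega))]
    linarith [hh c (by omega)]

lemma sum_pairs_up (h : ℕ → ℝ) (c N : ℕ) (hcN : c ≤ N)
    (h0 : ∑ l ∈ Finset.range (2*c+1), h (l+1) = 0)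
    (hh : ∀ b, c < b → b ≤ N → h (2*b) + h (2*b+1) = 0) :
    ∑ l ∈ Finset.range (2*N+1), h (l+1) = 0 := by
  induction N, hcN using Nat.le_induction with
  | base => exact h0
  | succ N hN ih =>
    rw [show 2*(N+1)+1 = 2*N+1+1+1 by ring, Finset.sum_range_succ, Finset.sum_range_succ,
      ih (fun b hb hb' => hh b hb (by omega))]
    have := hh (N+1) (by omega) le_rfl
    rw [show 2*(N+1) = 2*N+1+1 by ring] at this
    linarith

lemma pow_par_even {a : ℕ} (h : Even a) : (-1:ℝ)^a = 1 := h.neg_one_pow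

section rows
variable {m : ℕ} {x : Fin (2*m+1) → ℝ}

lemma pi1_up {k l : ℕ} (h1 : 1 ≤ k) (h2 : k < l) (h3 : l + 2 ≤ 2*m+1) :
    pi1 (2*m+1) x k l = (-1 : ℝ)^(k + l - 1) * tauD (2*m+1) x (k/2 + 1) ((l+1)/2) := by
  unfold pi1 pi1B
  rw [if_pos h2, if_pos (by omega)]

lemma pi1_dn {k l : ℕ} (h1 : 1 ≤ l) (h2 : l < k) (h3 : k + 2 ≤ 2*m+1) :
    pi1 (2*m+1) x k l = -((-1 : ℝ)^(l + k - 1) * tauD (2*m+1) x (l/2 + 1) ((k+1)/2)) := by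
  unfold pi1 pi1B
  rw [if_neg (by omega), if_pos h2, if_pos (by omega)]

lemma pi1_last {k l : ℕ} (h1 : 1 ≤ l) (h2 : l + 2 ≤ 2*m+1) (h3 : k = 2*m ∨ k = 2*m+1) :
    pi1 (2*m+1) x k l = -((-1 : ℝ)^(l + (2*m+1)) / 2 * tauD (2*m+1) x (l/2 + 1) m) := by
  unfold pi1 pi1B
  rw [if_neg (by omega), if_pos (by omega), if_neg (by omega), if_pos (by omega)]
  congr 3
  omega

lemma pair_up (hx : ∀ i, x i ≠ 0) {k b : ℕ} (h1 : 1 ≤ k) (h2 : k < 2*b) (h3 : b + 1 ≤ m) :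
    pi1 (2*m+1) x k (2*b) / coord _ x (2*b) +
      pi1 (2*m+1) x k (2*b+1) / coord _ x (2*b+1) = 0 := by
  have e1 := coord_ne hx (i := 2*b) (by omega) (by omega)
  have e2 := coord_ne hx (i := 2*b+1) (by omega) (by omega)
  rw [pi1_up h1 h2 (by omega), pi1_up h1 (by omega) (by omega),
    show (2*b+1)/2 = b by omega, show (2*b+1+1)/2 = b+1 by omega,
    show k + (2*b+1) - 1 = (k+2*b-1)+1 by omega, tauD_right _ _ (by omega), pow_succ]
  field_simp
  ring

lemma pair_left (hx : ∀ i, x i ≠ 0) {b c : ℕ} (h2 : b + 1 < c) (h3 : b + 1 ≤ m) :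
    tauD (2*m+1) x (b+1) c / coord _ x (2*b+1) =
      tauD (2*m+1) x (b+1+1) c / coord _ x (2*b+2) := by
  have e1 := coord_ne hx (i := 2*b+1) (by omega) (by omega)
  have e2 := coord_ne hx (i := 2*b+2) (by omega) (by omega)
  have := tauD_left (x := x) h2 e2
  rw [show 2*(b+1)-1 = 2*b+1 by omega, show 2*(b+1) = 2*b+2 by omega] at this
  rw [div_eq_div_iff e1 e2, this, mul_comm]

lemma pair_dn (hx : ∀ i, x i ≠ 0) {k b : ℕ} (h1 : 2*b+2 < k) (h3 : k + 2 ≤ 2*m+1) :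
    pi1 (2*m+1) x k (2*b+1) / coord _ x (2*b+1) +
      pi1 (2*m+1) x k (2*b+2) / coord _ x (2*b+2) = 0 := by
  have := pair_left hx (b := b) (c := (k+1)/2) (by omega) (by omega)
  rw [pi1_dn (by omega) (by omega) h3, pi1_dn (by omega) (by omega) h3,
    show (2*b+1)/2 = b by omega, show (2*b+2)/2 = b+1 by omega,
    show (2*b+2) + k - 1 = (2*b+1 + k-1)+1 by omega, pow_succ, neg_div, neg_div,
    mul_div_assoc, mul_div_assoc, this]
  ring

lemma pair_last (hx : ∀ i, x i ≠ 0) {k b : ℕ} (h1 : b + 1 < m) (h3 : k = 2*m ∨ k = 2*m+1) :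
    pi1 (2*m+1) x k (2*b+1) / coord _ x (2*b+1) +
      pi1 (2*m+1) x k (2*b+2) / coord _ x (2*b+2) = 0 := by
  have := pair_left hx (b := b) (c := m) (by omega) (by omega)
  rw [pi1_last (by omega) (by omega) h3, pi1_last (by omega) (by omega) h3,
    show (2*b+1)/2 = b by omega, show (2*b+2)/2 = b+1 by omega,
    show (2*b+2) + (2*m+1) = (2*b+1 + (2*m+1))+1 by omega, pow_succ, neg_div, neg_div,
    mul_div_assoc, mul_div_assoc, this]
  ring

lemma row_small (hx : ∀ i, x i ≠ 0) {k p : ℕ} (hp : m = p + 1) (h1 : 1 ≤ k) (h2 : k ≤ 2*p+1) :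
    ∑ l ∈ Finset.range (2*p+1), pi1 (2*m+1) x k (l+1) / coord (2*m+1) x (l+1) = 0 := by
  have key : ∀ j, pi1 (2*m+1) x j j = 0 := by intro j; simp [pi1]
  rcases Nat.even_or_odd' k with ⟨a, ha | ha⟩
  · obtain ⟨a, rfl⟩ : ∃ a', a = a' + 1 := ⟨a - 1, by omega⟩
    have e1 := coord_ne hx (i := 2*a+1) (by omega) (by omega)
    have e3 := coord_ne hx (i := 2*a+3) (by omega) (by omega)
    apply sum_pairs_up (fun l => pi1 (2*m+1) x k l / coord (2*m+1) x l) (a+1) p (by omega)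
    · rw [show 2*(a+1)+1 = 2*a+1+1+1 by ring, Finset.sum_range_succ, Finset.sum_range_succ,
        Finset.sum_range_succ,
        sum_pairs_low (fun l => pi1 (2*m+1) x k l / coord (2*m+1) x l) a
          (fun b hb => pair_dn hx (by omega) (by omega))]
      rw [show 2*a+1+1 = k by omega, key, pi1_dn (by omega) (by omega) (by omega),
        pi1_up (by omega) (by omega) (by omega),
        show k + (k+1) - 1 = 2*k by omega, show 2*a+1+k-1 = 2*(2*a+1) by omega,
        show (2*a+1)/2+1 = a+1 by omega, show (k+1)/2 = a+1 by omega,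
        show k/2+1 = a+2 by omega, show (k+1+1)/2 = a+2 by omega, tauD_self, tauD_self,
        show 2*(a+1)-1 = 2*a+1 by omega, show 2*(a+2)-1 = 2*a+3 by omega,
        show k+1 = 2*a+3 by omega, pow_par_even (even_two_mul _), pow_par_even (even_two_mul _)]
      field_simp
      ring
    · intro b hb hb'
      exact pair_up hx h1 (by omega) (by omega)
  · apply sum_pairs_up (fun l => pi1 (2*m+1) x k l / coord (2*m+1) x l) a p (by omega)
    · rw [Finset.sum_range_succ,
        sum_pairs_low (fun l => pi1 (2*m+1) x k l / coord (2*m+1) x l) a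
          (fun b hb => pair_dn hx (by omega) (by omega)), ← ha, key]
      simp
    · intro b hb hb'
      exact pair_up hx h1 (by omega) (by omega)

lemma row_last (hx : ∀ i, x i ≠ 0) {k p : ℕ} (hp : m = p + 1) (h3 : k = 2*m ∨ k = 2*m+1) :
    ∑ l ∈ Finset.range (2*p+1), pi1 (2*m+1) x k (l+1) / coord (2*m+1) x (l+1) = -1/2 := by
  have e1 := coord_ne hx (i := 2*p+1) (by omega) (by omega)
  rw [Finset.sum_range_succ,
    sum_pairs_low (fun l => pi1 (2*m+1) x k l / coord (2*m+1) x l) p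
      (fun b hb => pair_last hx (by omega) h3),
    pi1_last (by omega) (by omega) h3, show (2*p+1)/2+1 = m by omega, tauD_self,
    show 2*m-1 = 2*p+1 by omega, show 2*p+1+(2*m+1) = 2*(p+m+1) by omega,
    pow_par_even (even_two_mul _)]
  field_simp
  ring

end rows

/-- for odd `n = 2m+1 ≥ 5`, the function `F = (v_n - v_{n-1}) Π_{i=1}^{n-2} v_i`
is a Casimir of `π₁` on the open set where all coordinates are nonzero: `π₁ ∇F = 0`. -/
theorem F_casimir_of_pi1 (m : ℕ) (hm : 2 ≤ m) (x : Fin (2*m+1) → ℝ)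
    (hx : ∀ i, x i ≠ 0) (k : ℕ) (hk1 : 1 ≤ k) (hk2 : k ≤ 2*m+1) :
    ∑ l : Fin (2*m+1),
        pi1 (2*m+1) x k ((l : ℕ) + 1) * fderiv ℝ (Ffun (2*m+1)) x (Pi.single l 1) = 0 := by
  obtain ⟨p, hp⟩ : ∃ p, m = p + 1 := ⟨m - 1, by omega⟩
  have h1 : ∀ l : Fin (2*m+1),
      pi1 (2*m+1) x k ((l : ℕ) + 1) * fderiv ℝ (Ffun (2*m+1)) x (Pi.single l 1) =
      (fun l : ℕ => pi1 (2*m+1) x k (l+1) * grd (2*m+1) x (l+1)) l := by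
    intro l
    rw [fderiv_grd _ (by omega) x hx]
  rw [Finset.sum_congr rfl (fun l _ => h1 l), Fin.sum_univ_eq_sum_range
    (fun l : ℕ => pi1 (2*m+1) x k (l+1) * grd (2*m+1) x (l+1)) (2*m+1),
    Finset.sum_range_succ]
  have h2 : ∑ l ∈ Finset.range (2*m), pi1 (2*m+1) x k (l+1) * grd (2*m+1) x (l+1) =
      Ffun (2*m+1) x * (∑ l ∈ Finset.range (2*p+1),
        pi1 (2*m+1) x k (l+1) / coord (2*m+1) x (l+1))
      + pi1 (2*m+1) x k (2*m) * grd (2*m+1) x (2*m) := by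
    rw [show Finset.range (2*m) = Finset.range (2*p+1+1) by congr 1; omega,
      Finset.sum_range_succ, show 2*p+1+1 = 2*m by omega, Finset.mul_sum]
    congr 1
    apply Finset.sum_congr rfl
    intro l hl
    rw [Finset.mem_range] at hl
    unfold grd
    rw [if_neg (by omega), if_neg (by omega)]
    ring
  rw [h2]
  have g1 : grd (2*m+1) x (2*m+1) = ∏ i ∈ Finset.Icc 1 (2*m+1-2), coord (2*m+1) x i := by
    simp [grd]
  have g2 : grd (2*m+1) x (2*m) = -∏ i ∈ Finset.Icc 1 (2*m+1-2), coord (2*m+1) x i := by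
    simp [grd]
  rw [g1, g2]
  by_cases hk : k ≤ 2*p+1
  · rw [row_small hx hp hk1 hk]
    have : pi1 (2*m+1) x k (2*m) = pi1 (2*m+1) x k (2*m+1) := by
      have q : ∀ j, j = 2*m ∨ j = 2*m+1 → pi1 (2*m+1) x k j =
          ((-1 : ℝ)^(k + (2*m+1)) / 2) * tauD (2*m+1) x (k/2 + 1) ((2*m+1)/2) := by
        intro j hj
        unfold pi1 pi1B
        rw [if_pos (by omega), if_neg (by omega), if_pos (by omega)]
      rw [q _ (Or.inl rfl), q _ (Or.inr rfl)]
    rw [this]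
    ring
  · have hk3 : k = 2*m ∨ k = 2*m+1 := by omega
    rw [row_last hx hp hk3]
    have q : pi1B (2*m+1) x (2*m) (2*m+1) =
        (1/2) * (coord (2*m+1) x (2*m+1) - coord (2*m+1) x (2*m+1-1)) := by
      unfold pi1B
      rw [if_neg (by omega), if_neg (by omega), if_pos (by omega)]
    unfold Ffun
    rcases hk3 with rfl | rfl
    · simp only [pi1, lt_irrefl, if_false, if_pos (Nat.lt_succ_self (2*m)), q]
      ring
    · simp only [pi1, lt_irrefl, if_false, if_pos (Nat.lt_succ_self (2*m)),
        if_neg (show ¬ (2*m+1 < 2*m) by omega), q]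
      ring
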